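/- arXiv:2310.14698 — 5 statements merged into one kernel-verified Lean document; each statement's English description precedes it below -/
import Mathlib

section
/- A couple (Σ_{3,1,2,1}, Ω), where Ω is a 6-letter word with three letters P and three letters N, is realizable if and only if Ω is one of the five orders PPPNNN, PPNPNN, PPNNPN, PNPPNN, NPPPNN. Explicitly: for each of these five orders there exist reals as in the setup realizing the sign pattern (+,+,+,−,+,+,−) with that order of moduli, and conversely every monic degree-6 hyperbolic polynomial with pairwise distinct moduli of roots and coefficient signs (+,+,+,−,+,+,−) has its order of moduli equal to one of these five. -/
open Polynomial

/-- The monic degree-6 hyperbolic polynomial with positive roots `α1, α2, α3`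
and negative roots `-γ1, -γ2, -γ3`. -/
noncomputable def hp6 (α1 α2 α3 γ1 γ2 γ3 : ℝ) : Polynomial ℝ :=
  (X - C α1) * (X - C α2) * (X - C α3) * (X + C γ1) * (X + C γ2) * (X + C γ3)

/-- The six moduli, listed in increasing order, form the word `Ω`
(`true` = letter `P`, i.e. the modulus of a positive root;
`false` = letter `N`, i.e. the modulus of a negative root). -/
def hasOrder (α1 α2 α3 γ1 γ2 γ3 : ℝ) (Ω : Fin 6 → Bool) : Prop :=
  ∃ m : Fin 6 → ℝ, StrictMono m ∧
    Set.range m = ({α1, α2, α3, γ1, γ2, γ3} : Set ℝ) ∧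
    ∀ i : Fin 6, (Ω i = true ↔ (m i = α1 ∨ m i = α2 ∨ m i = α3))

/-- `p` has the sign pattern `σ` read from the leading coefficient (index `0` of `σ`,
coefficient of `x^6`) to the constant term (`true` = `+`, `false` = `-`). -/
def hasSigns (p : Polynomial ℝ) (σ : Fin 7 → Bool) : Prop :=
  ∀ j : Fin 7, p.coeff (6 - (j : ℕ)) ≠ 0 ∧ (0 < p.coeff (6 - (j : ℕ)) ↔ σ j = true)

/-- The couple (sign pattern `σ`, order of moduli `Ω`) is realizable by a monic
degree-6 hyperbolic polynomial with pairwise distinct moduli of roots. -/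
def realizable (σ : Fin 7 → Bool) (Ω : Fin 6 → Bool) : Prop :=
  ∃ α1 α2 α3 γ1 γ2 γ3 : ℝ,
    0 < α1 ∧ α1 < α2 ∧ α2 < α3 ∧ 0 < γ1 ∧ γ1 < γ2 ∧ γ2 < γ3 ∧
    α1 ≠ γ1 ∧ α1 ≠ γ2 ∧ α1 ≠ γ3 ∧ α2 ≠ γ1 ∧ α2 ≠ γ2 ∧ α2 ≠ γ3 ∧
    α3 ≠ γ1 ∧ α3 ≠ γ2 ∧ α3 ≠ γ3 ∧
    hasOrder α1 α2 α3 γ1 γ2 γ3 Ω ∧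
    hasSigns (hp6 α1 α2 α3 γ1 γ2 γ3) σ

theorem hp6_eq_sum (α1 α2 α3 γ1 γ2 γ3 : ℝ) :
    hp6 α1 α2 α3 γ1 γ2 γ3 = X ^ 6
      + C ((γ1 + γ2 + γ3) - (α1 + α2 + α3)) * X ^ 5
      + C ((γ1 * γ2 + γ2 * γ3 + γ3 * γ1) - (α1 + α2 + α3) * (γ1 + γ2 + γ3)
          + (α1 * α2 + α2 * α3 + α3 * α1)) * X ^ 4
      + C (γ1 * γ2 * γ3 - (α1 + α2 + α3) * (γ1 * γ2 + γ2 * γ3 + γ3 * γ1)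
          + (α1 * α2 + α2 * α3 + α3 * α1) * (γ1 + γ2 + γ3) - α1 * α2 * α3) * X ^ 3
      + C (-(α1 + α2 + α3) * (γ1 * γ2 * γ3)
          + (α1 * α2 + α2 * α3 + α3 * α1) * (γ1 * γ2 + γ2 * γ3 + γ3 * γ1)
          - α1 * α2 * α3 * (γ1 + γ2 + γ3)) * X ^ 2
      + C ((α1 * α2 + α2 * α3 + α3 * α1) * (γ1 * γ2 * γ3)
          - α1 * α2 * α3 * (γ1 * γ2 + γ2 * γ3 + γ3 * γ1)) * X
      + C (-(α1 * α2 * α3 * (γ1 * γ2 * γ3))) := by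
  simp only [hp6, map_add, map_sub, map_mul, map_neg]
  ring

theorem hasSigns_sextic_iff (c5 c4 c3 c2 c1 c0 : ℝ) :
    hasSigns (X ^ 6 + C c5 * X ^ 5 + C c4 * X ^ 4 + C c3 * X ^ 3 + C c2 * X ^ 2 + C c1 * X + C c0)
        ![true, true, true, false, true, true, false] ↔
      0 < c5 ∧ 0 < c4 ∧ c3 < 0 ∧ 0 < c2 ∧ 0 < c1 ∧ c0 < 0 := by
  have neg_iff (c : ℝ) : (c ≠ 0 ∧ c ≤ 0) ↔ c < 0 := by rw [lt_iff_le_and_ne, and_comm]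
  have pos_iff (c : ℝ) : (c ≠ 0 ∧ 0 < c) ↔ 0 < c := and_iff_right_of_imp ne_of_gt
  simp [hasSigns, Fin.forall_fin_succ, coeff_X, coeff_C, coeff_X_pow, neg_iff, pos_iff, -ne_eq]
  exact fun _ _ _ _ _ _ => one_ne_zero

/-- The sign pattern `(+,+,+,-,+,+,-)` in terms of the roots. -/
theorem hasSigns_hp6_iff (α1 α2 α3 γ1 γ2 γ3 : ℝ) :
    hasSigns (hp6 α1 α2 α3 γ1 γ2 γ3) ![true, true, true, false, true, true, false] ↔
      0 < (γ1 + γ2 + γ3) - (α1 + α2 + α3) ∧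
      0 < (γ1 * γ2 + γ2 * γ3 + γ3 * γ1) - (α1 + α2 + α3) * (γ1 + γ2 + γ3)
          + (α1 * α2 + α2 * α3 + α3 * α1) ∧
      γ1 * γ2 * γ3 - (α1 + α2 + α3) * (γ1 * γ2 + γ2 * γ3 + γ3 * γ1)
          + (α1 * α2 + α2 * α3 + α3 * α1) * (γ1 + γ2 + γ3) - α1 * α2 * α3 < 0 ∧
      0 < -(α1 + α2 + α3) * (γ1 * γ2 * γ3)
          + (α1 * α2 + α2 * α3 + α3 * α1) * (γ1 * γ2 + γ2 * γ3 + γ3 * γ1)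
          - α1 * α2 * α3 * (γ1 + γ2 + γ3) ∧
      0 < (α1 * α2 + α2 * α3 + α3 * α1) * (γ1 * γ2 * γ3)
          - α1 * α2 * α3 * (γ1 * γ2 + γ2 * γ3 + γ3 * γ1) ∧
      -(α1 * α2 * α3 * (γ1 * γ2 * γ3)) < 0 := by
  rw [hp6_eq_sum, hasSigns_sextic_iff]

/-- If the coefficients of `x^5` and `x^4` are positive, then the largest modulus belongs to a
negative root, and either the second largest does too, or `α2 < γ1`. -/
theorem lt_of_coeff_pos {α1 α2 α3 γ1 γ2 γ3 : ℝ}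
    (hα1 : 0 < α1) (hα12 : α1 < α2) (hγ1 : 0 < γ1) (hγ12 : γ1 < γ2) (hγ23 : γ2 < γ3)
    (h5 : 0 < (γ1 + γ2 + γ3) - (α1 + α2 + α3))
    (h4 : 0 < (γ1 * γ2 + γ2 * γ3 + γ3 * γ1) - (α1 + α2 + α3) * (γ1 + γ2 + γ3)
          + (α1 * α2 + α2 * α3 + α3 * α1)) :
    α3 < γ3 ∧ (α3 < γ2 ∨ α2 < γ1) := by
  have key : γ1 ^ 2 + γ2 ^ 2 + γ3 ^ 2 + α1 ^ 2 + α2 ^ 2 + α3 ^ 2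
      < ((γ1 + γ2 + γ3) - (α1 + α2 + α3)) ^ 2 := by
    linear_combination 2 * h4
  constructor
  · by_contra! h
    have hsq : ((γ1 + γ2 + γ3) - (α1 + α2 + α3)) ^ 2 ≤ (γ1 + γ2) ^ 2 :=
      pow_le_pow_left₀ h5.le (by linarith) 2
    nlinarith [sq_nonneg (γ1 - γ2), sq_nonneg α1, sq_nonneg α2,
      pow_le_pow_left₀ hγ1.le hγ12.le 2, pow_le_pow_left₀ (hγ1.trans hγ12).le hγ23.le 2,
      pow_le_pow_left₀ ((hγ1.trans hγ12).trans hγ23).le h 2]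
  · by_contra! h
    have hsq : ((γ1 + γ2 + γ3) - (α1 + α2 + α3)) ^ 2 ≤ γ3 ^ 2 :=
      pow_le_pow_left₀ h5.le (by linarith [h.1, h.2]) 2
    nlinarith [sq_nonneg γ1, sq_nonneg γ2, sq_nonneg α1, sq_nonneg α2, sq_nonneg α3]

theorem hasOrder_of_lt {α1 α2 α3 γ1 γ2 γ3 : ℝ} {Ω : Fin 6 → Bool} (m0 m1 m2 m3 m4 m5 : ℝ)
    (hm : m0 < m1 ∧ m1 < m2 ∧ m2 < m3 ∧ m3 < m4 ∧ m4 < m5)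
    (hr : ∀ x, (x = m0 ∨ x = m1 ∨ x = m2 ∨ x = m3 ∨ x = m4 ∨ x = m5) ↔
      (x = α1 ∨ x = α2 ∨ x = α3 ∨ x = γ1 ∨ x = γ2 ∨ x = γ3))
    (hΩ : ∀ i : Fin 6, (Ω i = true ↔ (![m0, m1, m2, m3, m4, m5] i = α1 ∨
      ![m0, m1, m2, m3, m4, m5] i = α2 ∨ ![m0, m1, m2, m3, m4, m5] i = α3))) :
    hasOrder α1 α2 α3 γ1 γ2 γ3 Ω := by
  obtain ⟨h01, h12, h23, h34, h45⟩ := hm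
  refine ⟨![m0, m1, m2, m3, m4, m5], Fin.strictMono_iff_lt_succ.2 fun i => ?_, ?_, hΩ⟩
  · fin_cases i <;> assumption
  · ext x
    simp only [Set.mem_range, Set.mem_insert_iff, Set.mem_singleton_iff, ← hr x]
    simp [Fin.exists_fin_succ, eq_comm]

/-- The combinatorial restriction on the order of moduli imposed by `lt_of_coeff_pos`. -/
theorem hasOrder.eq_false_of_lt {α1 α2 α3 γ1 γ2 γ3 : ℝ} {Ω : Fin 6 → Bool}
    (h : hasOrder α1 α2 α3 γ1 γ2 γ3 Ω) (hα12 : α1 < α2) (hα23 : α2 < α3)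
    (hγ12 : γ1 < γ2) (hγ23 : γ2 < γ3) (hne : α3 ≠ γ2) (h3 : α3 < γ3) (h2 : α3 < γ2 ∨ α2 < γ1) :
    Ω 5 = false ∧ (Ω 4 = false ∨ (Ω 2 = false ∧ Ω 3 = false)) := by
  obtain ⟨m, hm, hr, hΩ⟩ := h
  have hmem (x : ℝ) (hx : x ∈ ({α1, α2, α3, γ1, γ2, γ3} : Set ℝ)) : ∃ i, m i = x := by
    rwa [← hr] at hx
  obtain ⟨a, rfl⟩ := hmem γ1 (by simp)
  obtain ⟨b, rfl⟩ := hmem γ2 (by simp)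
  obtain ⟨c, rfl⟩ := hmem γ3 (by simp)
  have hab := hm.lt_iff_lt.1 hγ12
  have hbc := hm.lt_iff_lt.1 hγ23
  have le3 {i : Fin 6} (hi : Ω i = true) : m i ≤ α3 := by
    rcases (hΩ i).1 hi with h | h | h <;> linarith
  have le2 {i j : Fin 6} (hi : Ω i = true) (hj : Ω j = true) (hij : i < j) : m i ≤ α2 := by
    have := hm hij
    have := le3 hj
    rcases (hΩ i).1 hi with h | h | h <;> linarith
  simp only [← Bool.not_eq_true]
  refine ⟨fun h5 => ?_, ?_⟩
  · have := hm.lt_iff_lt.1 ((le3 h5).trans_lt h3)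
    omega
  · by_contra! H
    obtain ⟨h4, H⟩ := H
    rcases h2 with h2 | h2
    · have := hm.lt_iff_lt.1 ((le3 h4).trans_lt h2)
      omega
    · by_cases h : Ω 2 = true
      · have := hm.lt_iff_lt.1 ((le2 h h4 (by decide)).trans_lt h2)
        obtain rfl : b = 4 := by omega
        have := hm.lt_iff_lt.1 ((le2 h h4 (by decide)).trans_lt h2)
        rcases (hΩ 4).1 h4 with h | h | h
        · linarith
        · linarith
        · exact hne h.symm
      · have := hm.lt_iff_lt.1 ((le2 (H h) h4 (by decide)).trans_lt h2)
        omega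

/-- The couple `(Σ_{3,1,2,1}, Ω)` is realizable iff `Ω` is one of
`PPPNNN`, `PPNPNN`, `PPNNPN`, `PNPPNN`, `NPPPNN`. -/
theorem sigma3121_realizable_orders (Ω : Fin 6 → Bool)
    (hΩ : (Finset.univ.filter fun i => Ω i = true).card = 3) :
    realizable ![true, true, true, false, true, true, false] Ω ↔
      (Ω = ![true, true, true, false, false, false] ∨
       Ω = ![true, true, false, true, false, false] ∨
       Ω = ![true, true, false, false, true, false] ∨
       Ω = ![true, false, true, true, false, false] ∨
       Ω = ![false, true, true, true, false, false]) := by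
  constructor
  · rintro ⟨α1, α2, α3, γ1, γ2, γ3, hα1, hα12, hα23, hγ1, hγ12, hγ23, -, -, -, -, -, -, -, h32, -,
      hord, hs⟩
    obtain ⟨h5, h4, -⟩ := (hasSigns_hp6_iff ..).1 hs
    obtain ⟨h3, h2⟩ := lt_of_coeff_pos hα1 hα12 hγ1 hγ12 hγ23 h5 h4
    have := hord.eq_false_of_lt hα12 hα23 hγ12 hγ23 h32 h3 h2
    clear hord
    revert Ω
    decide
  · rintro (rfl | rfl | rfl | rfl | rfl)
    · refine ⟨2, 3, 4, 5, 10, 11, ?_⟩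
      norm_num
      exact ⟨hasOrder_of_lt 2 3 4 5 10 11 (by norm_num)
        (by intro x; tauto) (by intro i; fin_cases i <;> norm_num),
        (hasSigns_hp6_iff ..).2 (by norm_num)⟩
    · refine ⟨1, 2, 4, 3, 8, 11, ?_⟩
      norm_num
      exact ⟨hasOrder_of_lt 1 2 3 4 8 11 (by norm_num)
        (by intro x; tauto) (by intro i; fin_cases i <;> norm_num),
        (hasSigns_hp6_iff ..).2 (by norm_num)⟩
    · refine ⟨5, 12, 23, 21, 22, 296, ?_⟩
      norm_num
      exact ⟨hasOrder_of_lt 5 12 21 22 23 296 (by norm_num)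
        (by intro x; tauto) (by intro i; fin_cases i <;> norm_num),
        (hasSigns_hp6_iff ..).2 (by norm_num)⟩
    · refine ⟨1, 4, 5, 2, 15, 18, ?_⟩
      norm_num
      exact ⟨hasOrder_of_lt 1 2 4 5 15 18 (by norm_num)
        (by intro x; tauto) (by intro i; fin_cases i <;> norm_num),
        (hasSigns_hp6_iff ..).2 (by norm_num)⟩
    · refine ⟨3, 4, 5, 2, 19, 20, ?_⟩
      norm_num
      exact ⟨hasOrder_of_lt 2 3 4 5 19 20 (by norm_num)
        (by intro x; tauto) (by intro i; fin_cases i <;> norm_num),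
        (hasSigns_hp6_iff ..).2 (by norm_num)⟩
end

section
/- A couple (Σ_{2,2,2,1}, Ω), where Ω is a 6-letter word with three letters P and three letters N, is realizable if and only if Ω is NOT one of the five orders NPNPNP, NPNNPP, NNPPNP, NNPNPP, NNNPPP. Explicitly: no monic degree-6 hyperbolic polynomial with pairwise distinct moduli of roots and coefficient signs (+,+,−,−,+,+,−) has its order of moduli among these five, and for each of the remaining fifteen words with three P's and three N's there exist reals as in the setup realizing the sign pattern (+,+,−,−,+,+,−) with that order of moduli. -/
open Polynomial

/-- The coefficients of `hp6` in terms of the elementary symmetric functions of the moduli. -/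
lemma hp6_eq (α1 α2 α3 γ1 γ2 γ3 : ℝ) :
    hp6 α1 α2 α3 γ1 γ2 γ3 = X ^ 6 +
      C (γ1 + γ2 + γ3 - (α1 + α2 + α3)) * X ^ 5 +
      C (γ1 * γ2 + γ1 * γ3 + γ2 * γ3 - (α1 + α2 + α3) * (γ1 + γ2 + γ3) +
        (α1 * α2 + α1 * α3 + α2 * α3)) * X ^ 4 +
      C (γ1 * γ2 * γ3 - (α1 + α2 + α3) * (γ1 * γ2 + γ1 * γ3 + γ2 * γ3) +
        (α1 * α2 + α1 * α3 + α2 * α3) * (γ1 + γ2 + γ3) - α1 * α2 * α3) * X ^ 3 +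
      C (-(α1 + α2 + α3) * (γ1 * γ2 * γ3) +
        (α1 * α2 + α1 * α3 + α2 * α3) * (γ1 * γ2 + γ1 * γ3 + γ2 * γ3) -
        α1 * α2 * α3 * (γ1 + γ2 + γ3)) * X ^ 2 +
      C ((α1 * α2 + α1 * α3 + α2 * α3) * (γ1 * γ2 * γ3) -
        α1 * α2 * α3 * (γ1 * γ2 + γ1 * γ3 + γ2 * γ3)) * X +
      C (-(α1 * α2 * α3 * (γ1 * γ2 * γ3))) := by
  simp only [hp6, map_add, map_sub, map_mul, map_neg]
  ring

lemma hp6_coeff_five (α1 α2 α3 γ1 γ2 γ3 : ℝ) :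
    (hp6 α1 α2 α3 γ1 γ2 γ3).coeff 5 = γ1 + γ2 + γ3 - (α1 + α2 + α3) := by
  rw [hp6_eq]
  simp only [coeff_add, coeff_C_mul, coeff_X_pow, coeff_X, coeff_C]
  norm_num

/-- The sign pattern `Σ_{2,2,2,1}` expressed by inequalities between symmetric functions. -/
lemma hasSigns_hp6_of_ineq {α1 α2 α3 γ1 γ2 γ3 : ℝ}
    (h5 : 0 < γ1 + γ2 + γ3 - (α1 + α2 + α3))
    (h4 : γ1 * γ2 + γ1 * γ3 + γ2 * γ3 - (α1 + α2 + α3) * (γ1 + γ2 + γ3) +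
      (α1 * α2 + α1 * α3 + α2 * α3) < 0)
    (h3 : γ1 * γ2 * γ3 - (α1 + α2 + α3) * (γ1 * γ2 + γ1 * γ3 + γ2 * γ3) +
      (α1 * α2 + α1 * α3 + α2 * α3) * (γ1 + γ2 + γ3) - α1 * α2 * α3 < 0)
    (h2 : 0 < -(α1 + α2 + α3) * (γ1 * γ2 * γ3) +
      (α1 * α2 + α1 * α3 + α2 * α3) * (γ1 * γ2 + γ1 * γ3 + γ2 * γ3) -
      α1 * α2 * α3 * (γ1 + γ2 + γ3))
    (h1 : 0 < (α1 * α2 + α1 * α3 + α2 * α3) * (γ1 * γ2 * γ3) -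
      α1 * α2 * α3 * (γ1 * γ2 + γ1 * γ3 + γ2 * γ3))
    (h0 : -(α1 * α2 * α3 * (γ1 * γ2 * γ3)) < 0) :
    hasSigns (hp6 α1 α2 α3 γ1 γ2 γ3) ![true, true, false, false, true, true, false] := by
  have pos {c : ℝ} (h : 0 < c) : c ≠ 0 ∧ (0 < c ↔ true = true) := ⟨h.ne', by simpa⟩
  have neg {c : ℝ} (h : c < 0) : c ≠ 0 ∧ (0 < c ↔ false = true) := ⟨h.ne, by simpa using h.le⟩
  rw [hp6_eq]
  intro j
  fin_cases j <;>
    [convert pos one_pos; convert pos h5; convert neg h4; convert neg h3; convert pos h2;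
      convert pos h1; convert neg h0] <;>
    simp only [coeff_add, coeff_C_mul, coeff_X_pow, coeff_X, coeff_C] <;> norm_num

/-- If the letters `P` and `N` of a strictly increasing list of moduli are carried by the triples
`α` and `γ`, then the moduli at the letters `P` (resp. `N`) sum to the sum of `α` (resp. `γ`). -/
lemma sum_eq_of_hasOrder {α1 α2 α3 γ1 γ2 γ3 : ℝ} {Ω : Fin 6 → Bool}
    (hα12 : α1 < α2) (hα23 : α2 < α3) (hγ12 : γ1 < γ2) (hγ23 : γ2 < γ3)
    (hγ1 : γ1 ≠ α1 ∧ γ1 ≠ α2 ∧ γ1 ≠ α3) (hγ2 : γ2 ≠ α1 ∧ γ2 ≠ α2 ∧ γ2 ≠ α3)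
    (hγ3 : γ3 ≠ α1 ∧ γ3 ≠ α2 ∧ γ3 ≠ α3) (h : hasOrder α1 α2 α3 γ1 γ2 γ3 Ω) :
    ∃ m : Fin 6 → ℝ, StrictMono m ∧
      (∑ i with Ω i = true, m i) = α1 + α2 + α3 ∧
      (∑ i with ¬ Ω i = true, m i) = γ1 + γ2 + γ3 := by
  obtain ⟨m, hm, hrange, hΩ⟩ := h
  have hmem (x : ℝ) : (∃ i, m i = x) ↔
      x = α1 ∨ x = α2 ∨ x = α3 ∨ x = γ1 ∨ x = γ2 ∨ x = γ3 := by
    simpa using Set.ext_iff.mp hrange x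
  have hP : (Finset.univ.filter fun i => Ω i = true).image m = {α1, α2, α3} := by
    ext x
    simp only [Finset.mem_image, Finset.mem_filter, Finset.mem_univ, true_and,
      Finset.mem_insert, Finset.mem_singleton]
    constructor
    · rintro ⟨i, hi, rfl⟩
      exact (hΩ i).mp hi
    · intro hx
      obtain ⟨i, rfl⟩ := (hmem x).mpr (by tauto)
      exact ⟨i, (hΩ i).mpr hx, rfl⟩
  have hN : (Finset.univ.filter fun i => ¬ Ω i = true).image m = {γ1, γ2, γ3} := by
    ext x
    simp only [Finset.mem_image, Finset.mem_filter, Finset.mem_univ, true_and,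
      Finset.mem_insert, Finset.mem_singleton]
    constructor
    · rintro ⟨i, hi, rfl⟩
      have := (hmem (m i)).mp ⟨i, rfl⟩
      have := mt (hΩ i).mpr hi
      tauto
    · intro hx
      obtain ⟨i, rfl⟩ := (hmem x).mpr (by tauto)
      refine ⟨i, fun hi => ?_, rfl⟩
      have := (hΩ i).mp hi
      rcases hx with hx | hx | hx <;> rw [hx] at this <;> tauto
  refine ⟨m, hm, ?_, ?_⟩
  · rw [← Finset.sum_image (f := fun x : ℝ => x) hm.injective.injOn, hP,
      Finset.sum_insert (by simp [hα12.ne, (hα12.trans hα23).ne]),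
      Finset.sum_pair hα23.ne, add_assoc]
  · rw [← Finset.sum_image (f := fun x : ℝ => x) hm.injective.injOn, hN,
      Finset.sum_insert (by simp [hγ12.ne, (hγ12.trans hγ23).ne]),
      Finset.sum_pair hγ23.ne, add_assoc]

/-- A word with three letters `P` and three letters `N` is one of the five words dominated
by `P`, or one of fifteen others. -/
lemma word_cases : ∀ Ω : Fin 6 → Bool, (Finset.univ.filter fun i => Ω i = true).card = 3 →
    ¬ (Ω = ![false, true, false, true, false, true] ∨
       Ω = ![false, true, false, false, true, true] ∨
       Ω = ![false, false, true, true, false, true] ∨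
       Ω = ![false, false, true, false, true, true] ∨
       Ω = ![false, false, false, true, true, true]) →
    Ω = ![false, false, true, true, true, false] ∨
    Ω = ![false, true, false, true, true, false] ∨
    Ω = ![false, true, true, false, false, true] ∨
    Ω = ![false, true, true, false, true, false] ∨
    Ω = ![false, true, true, true, false, false] ∨
    Ω = ![true, false, false, false, true, true] ∨
    Ω = ![true, false, false, true, false, true] ∨
    Ω = ![true, false, false, true, true, false] ∨
    Ω = ![true, false, true, false, false, true] ∨
    Ω = ![true, false, true, false, true, false] ∨
    Ω = ![true, false, true, true, false, false] ∨
    Ω = ![true, true, false, false, false, true] ∨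
    Ω = ![true, true, false, false, true, false] ∨
    Ω = ![true, true, false, true, false, false] ∨
    Ω = ![true, true, true, false, false, false] := by
  decide

/-- The first condition on the signs excludes every order in which the sum of the moduli at the
letters `N` is at most the sum of those at the letters `P`. -/
lemma not_realizable_of_sum_le {Ω : Fin 6 → Bool}
    (h : ∀ m : Fin 6 → ℝ, StrictMono m →
      (∑ i with ¬ Ω i = true, m i) ≤ ∑ i with Ω i = true, m i) :
    ¬ realizable ![true, true, false, false, true, true, false] Ω := by
  rintro ⟨α1, α2, α3, γ1, γ2, γ3, -, hα12, hα23, -, hγ12, hγ23, h11, h12, h13, h21, h22, h23,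
    h31, h32, h33, hord, hsigns⟩
  obtain ⟨m, hm, hP, hN⟩ := sum_eq_of_hasOrder hα12 hα23 hγ12 hγ23
    ⟨h11.symm, h21.symm, h31.symm⟩ ⟨h12.symm, h22.symm, h32.symm⟩
    ⟨h13.symm, h23.symm, h33.symm⟩ hord
  have h5 : 0 < (hp6 α1 α2 α3 γ1 γ2 γ3).coeff 5 := (hsigns 1).2.mpr rfl
  rw [hp6_coeff_five] at h5
  have := h m hm
  linarith

/-- Realizability from a list of integer moduli, with the positions `p` of the letters `P` and
`n` of the letters `N`. -/
lemma realizable_of_moduli {σ : Fin 7 → Bool} {Ω : Fin 6 → Bool} (m : Fin 6 → ℤ)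
    (p n : Fin 3 → Fin 6) (hm : ∀ i j, i < j → m i < m j) (hm0 : 0 < m 0)
    (hp : ∀ i j, i < j → p i < p j) (hn : ∀ i j, i < j → n i < n j)
    (hΩp : ∀ i, Ω i = true ↔ i = p 0 ∨ i = p 1 ∨ i = p 2)
    (hΩn : ∀ i, ¬ Ω i = true ↔ i = n 0 ∨ i = n 1 ∨ i = n 2)
    (hσ : hasSigns (hp6 (m (p 0)) (m (p 1)) (m (p 2)) (m (n 0)) (m (n 1)) (m (n 2))) σ) :
    realizable σ Ω := by
  let M : Fin 6 → ℝ := fun i => m i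
  have hM : StrictMono M := fun i j hij => Int.cast_lt.mpr (hm i j hij)
  have hM0 (i : Fin 6) : 0 < M i :=
    (Int.cast_pos.mpr hm0 : 0 < M 0).trans_le (hM.monotone (Fin.zero_le i))
  have hne (i j : Fin 3) : M (p i) ≠ M (n j) := by
    intro h
    have hΩ : Ω (p i) = true := (hΩp _).mpr (by fin_cases i <;> simp)
    rw [hM.injective h] at hΩ
    exact (hΩn _).mpr (by fin_cases j <;> simp) hΩ
  refine ⟨M (p 0), M (p 1), M (p 2), M (n 0), M (n 1), M (n 2), hM0 _,
    hM (hp 0 1 (by decide)), hM (hp 1 2 (by decide)), hM0 _, hM (hn 0 1 (by decide)),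
    hM (hn 1 2 (by decide)), hne _ _, hne _ _, hne _ _, hne _ _, hne _ _, hne _ _, hne _ _,
    hne _ _, hne _ _, ⟨M, hM, ?_, fun i => ?_⟩, hσ⟩
  · have huniv : (Set.univ : Set (Fin 6)) = {p 0, p 1, p 2, n 0, n 1, n 2} := by
      ext i
      have h1 := hΩp i
      have h2 := hΩn i
      simp only [Set.mem_univ, Set.mem_insert_iff, Set.mem_singleton_iff, true_iff]
      tauto
    rw [← Set.image_univ, huniv]
    simp only [Set.image_insert_eq, Set.image_singleton]
  · simp only [hM.injective.eq_iff, hΩp]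

/-- The couple `(Σ_{2,2,2,1}, Ω)` is realizable iff `Ω` is NOT one of
`NPNPNP`, `NPNNPP`, `NNPPNP`, `NNPNPP`, `NNNPPP`. -/
theorem sigma2221_realizable_orders (Ω : Fin 6 → Bool)
    (hΩ : (Finset.univ.filter fun i => Ω i = true).card = 3) :
    realizable ![true, true, false, false, true, true, false] Ω ↔
      ¬ (Ω = ![false, true, false, true, false, true] ∨
         Ω = ![false, true, false, false, true, true] ∨
         Ω = ![false, false, true, true, false, true] ∨
         Ω = ![false, false, true, false, true, true] ∨
         Ω = ![false, false, false, true, true, true]) := by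
  constructor
  · rintro hreal hbad
    refine not_realizable_of_sum_le (fun m hm => ?_) hreal
    have h01 : m 0 < m 1 := hm (by decide)
    have h12 : m 1 < m 2 := hm (by decide)
    have h23 : m 2 < m 3 := hm (by decide)
    have h34 : m 3 < m 4 := hm (by decide)
    have h45 : m 4 < m 5 := hm (by decide)
    rcases hbad with rfl | rfl | rfl | rfl | rfl <;>
      simp [Finset.sum_filter, Fin.sum_univ_six] <;> linarith
  · intro hgood
    rcases word_cases Ω hΩ hgood with
      rfl | rfl | rfl | rfl | rfl | rfl | rfl | rfl | rfl | rfl | rfl | rfl | rfl | rfl | rfl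
    · exact realizable_of_moduli ![9, 10, 11, 12, 13, 26] ![2, 3, 4] ![0, 1, 5] (by decide)
        (by decide) (by decide) (by decide) (by decide) (by decide)
        (by apply hasSigns_hp6_of_ineq <;> simp <;> norm_num)
    · exact realizable_of_moduli ![6, 7, 8, 9, 10, 17] ![1, 3, 4] ![0, 2, 5] (by decide)
        (by decide) (by decide) (by decide) (by decide) (by decide)
        (by apply hasSigns_hp6_of_ineq <;> simp <;> norm_num)
    · exact realizable_of_moduli ![4, 5, 6, 10, 11, 12] ![1, 2, 5] ![0, 3, 4] (by decide)
        (by decide) (by decide) (by decide) (by decide) (by decide)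
        (by apply hasSigns_hp6_of_ineq <;> simp <;> norm_num)
    · exact realizable_of_moduli ![3, 4, 5, 8, 9, 10] ![1, 2, 4] ![0, 3, 5] (by decide)
        (by decide) (by decide) (by decide) (by decide) (by decide)
        (by apply hasSigns_hp6_of_ineq <;> simp <;> norm_num)
    · exact realizable_of_moduli ![3, 4, 5, 6, 7, 8] ![1, 2, 3] ![0, 4, 5] (by decide)
        (by decide) (by decide) (by decide) (by decide) (by decide)
        (by apply hasSigns_hp6_of_ineq <;> simp <;> norm_num)
    · exact realizable_of_moduli ![1, 6, 7, 8, 9, 10] ![0, 4, 5] ![1, 2, 3] (by decide)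
        (by decide) (by decide) (by decide) (by decide) (by decide)
        (by apply hasSigns_hp6_of_ineq <;> simp <;> norm_num)
    · exact realizable_of_moduli ![1, 4, 5, 6, 7, 8] ![0, 3, 5] ![1, 2, 4] (by decide)
        (by decide) (by decide) (by decide) (by decide) (by decide)
        (by apply hasSigns_hp6_of_ineq <;> simp <;> norm_num)
    · exact realizable_of_moduli ![1, 2, 3, 4, 5, 6] ![0, 3, 4] ![1, 2, 5] (by decide)
        (by decide) (by decide) (by decide) (by decide) (by decide)
        (by apply hasSigns_hp6_of_ineq <;> simp <;> norm_num)
    · exact realizable_of_moduli ![1, 2, 3, 4, 5, 6] ![0, 2, 5] ![1, 3, 4] (by decide)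
        (by decide) (by decide) (by decide) (by decide) (by decide)
        (by apply hasSigns_hp6_of_ineq <;> simp <;> norm_num)
    · exact realizable_of_moduli ![1, 2, 3, 4, 5, 6] ![0, 2, 4] ![1, 3, 5] (by decide)
        (by decide) (by decide) (by decide) (by decide) (by decide)
        (by apply hasSigns_hp6_of_ineq <;> simp <;> norm_num)
    · exact realizable_of_moduli ![1, 2, 3, 4, 5, 6] ![0, 2, 3] ![1, 4, 5] (by decide)
        (by decide) (by decide) (by decide) (by decide) (by decide)
        (by apply hasSigns_hp6_of_ineq <;> simp <;> norm_num)
    · exact realizable_of_moduli ![1, 2, 3, 4, 5, 6] ![0, 1, 5] ![2, 3, 4] (by decide)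
        (by decide) (by decide) (by decide) (by decide) (by decide)
        (by apply hasSigns_hp6_of_ineq <;> simp <;> norm_num)
    · exact realizable_of_moduli ![1, 2, 3, 4, 5, 6] ![0, 1, 4] ![2, 3, 5] (by decide)
        (by decide) (by decide) (by decide) (by decide) (by decide)
        (by apply hasSigns_hp6_of_ineq <;> simp <;> norm_num)
    · exact realizable_of_moduli ![1, 2, 3, 4, 5, 6] ![0, 1, 3] ![2, 4, 5] (by decide)
        (by decide) (by decide) (by decide) (by decide) (by decide)
        (by apply hasSigns_hp6_of_ineq <;> simp <;> norm_num)
    · exact realizable_of_moduli ![1, 2, 3, 4, 5, 6] ![0, 1, 2] ![3, 4, 5] (by decide)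
        (by decide) (by decide) (by decide) (by decide) (by decide)
        (by apply hasSigns_hp6_of_ineq <;> simp <;> norm_num)
end

section
/- A couple (Σ_{3,2,1,1}, Ω), where Ω is a 6-letter word with three letters P and three letters N, is realizable if and only if Ω is one of the four orders PPPNNN, PPNPNN, PPNNPN, PNPPNN. Explicitly: for each of these four orders there exist reals as in the setup realizing the sign pattern (+,+,+,−,−,+,−) with that order of moduli, and conversely every monic degree-6 hyperbolic polynomial with pairwise distinct moduli of roots and coefficient signs (+,+,+,−,−,+,−) has its order of moduli equal to one of these four. -/
open Polynomial

lemma hp6_eq_s3 (a b c u v w : ℝ) :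
    hp6 a b c u v w = X ^ 6 + C ((u + v + w) - (a + b + c)) * X ^ 5
      + C ((u * v + u * w + v * w) - (a + b + c) * (u + v + w) + (a * b + a * c + b * c)) * X ^ 4
      + C (u * v * w - (a + b + c) * (u * v + u * w + v * w)
          + (a * b + a * c + b * c) * (u + v + w) - a * b * c) * X ^ 3
      + C (-(a + b + c) * (u * v * w) + (a * b + a * c + b * c) * (u * v + u * w + v * w)
          - a * b * c * (u + v + w)) * X ^ 2
      + C ((a * b + a * c + b * c) * (u * v * w) - a * b * c * (u * v + u * w + v * w)) * X
      + C (-(a * b * c * (u * v * w))) := by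
  simp only [hp6, map_add, map_sub, map_mul, map_neg]
  ring

lemma hasSigns_iff_of_monic_sextic (p1 p2 p3 p4 p5 p6 : ℝ) :
    hasSigns (X ^ 6 + C p1 * X ^ 5 + C p2 * X ^ 4 + C p3 * X ^ 3 + C p4 * X ^ 2 + C p5 * X + C p6)
      ![true, true, true, false, false, true, false] ↔
      0 < p1 ∧ 0 < p2 ∧ p3 < 0 ∧ p4 < 0 ∧ 0 < p5 ∧ p6 < 0 := by
  have pos (x : ℝ) : (¬x = 0 ∧ 0 < x) ↔ 0 < x := ⟨And.right, fun h => ⟨h.ne', h⟩⟩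
  have neg (x : ℝ) : (¬x = 0 ∧ x ≤ 0) ↔ x < 0 :=
    ⟨fun h => lt_of_le_of_ne h.2 h.1, fun h => ⟨h.ne, h.le⟩⟩
  simp [hasSigns, Fin.forall_fin_succ, coeff_X_pow, coeff_X, coeff_C, pos, neg]

/-- The order of moduli is read off from any increasing enumeration of the moduli. -/
lemma hasOrder.apply_iff {a b c u v w : ℝ} {Ω : Fin 6 → Bool} (h : hasOrder a b c u v w Ω)
    {m : Fin 6 → ℝ} (hm : StrictMono m) (hr : Set.range m = {a, b, c, u, v, w}) (i : Fin 6) :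
    Ω i = true ↔ (m i = a ∨ m i = b ∨ m i = c) := by
  obtain ⟨n, hn, hnr, hΩ⟩ := h
  rw [← (hn.range_inj hm).1 (hnr.trans hr.symm)]
  exact hΩ i

lemma strictMono_vec6 {x0 x1 x2 x3 x4 x5 : ℝ} (h0 : x0 < x1) (h1 : x1 < x2) (h2 : x2 < x3)
    (h3 : x3 < x4) (h4 : x4 < x5) : StrictMono ![x0, x1, x2, x3, x4, x5] := by
  rw [Fin.strictMono_iff_lt_succ]
  simp [Fin.forall_fin_succ, *]

lemma range_vec6 (x0 x1 x2 x3 x4 x5 : ℝ) :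
    Set.range ![x0, x1, x2, x3, x4, x5] = {x0, x1, x2, x3, x4, x5} := by
  ext x
  simp only [Set.mem_range, Fin.exists_fin_succ]
  simp [eq_comm]

/-- The inequalities on the coefficients of `x ^ 2` and `x` force the least modulus to belong
to a positive root. -/
lemma least_modulus_pos {a b c u v w : ℝ} (ha : 0 < a) (hb : a < b) (hc : b < c)
    (hu : 0 < u) (hv : 0 < v) (hw : 0 < w)
    (h2 : -(a + b + c) * (u * v * w) + (a * b + a * c + b * c) * (u * v + u * w + v * w)
          - a * b * c * (u + v + w) < 0)
    (h1 : 0 < (a * b + a * c + b * c) * (u * v * w) - a * b * c * (u * v + u * w + v * w)) :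
    a ≤ u := by
  by_contra! hua
  have hb0 := ha.trans hb
  have hc0 := hb0.trans hc
  have hS : 0 < v + w := by positivity
  have hT : 0 < v * w := by positivity
  have e3 : 0 < a * b * c := by positivity
  set S := v + w with hSd
  set T := v * w with hTd
  set k := (a * b + a * c + b * c) * u - a * b * c with hk
  have h1' : a * b * c * u * S < T * k := by
    rw [hk, hSd, hTd]; linarith
  have h2' : S * k + T * ((a * b + a * c + b * c) - (a + b + c) * u) < a * b * c * u := by
    rw [hk, hSd, hTd]; linarith
  have h3 : 0 < (a * b + a * c + b * c) - (a + b + c) * u := by nlinarith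
  have h4 : S * k < a * b * c * u := by nlinarith [mul_pos hT h3]
  have h5 : a * b * c * u * S * S < T * (a * b * c * u) := by
    nlinarith [mul_lt_mul_of_pos_right h1' hS, mul_lt_mul_of_pos_left h4 hT]
  have h6 : T ≤ S * S := by rw [hSd, hTd]; nlinarith
  nlinarith [mul_le_mul_of_nonneg_left h6 (mul_pos e3 hu).le]

/-- The inequalities on the coefficients of `x ^ 5` and `x ^ 4` force the largest modulus to belong
to a negative root. -/
lemma largest_modulus_neg {a b c u v w : ℝ} (ha : 0 < a) (hb : a < b) (hc : b < c)
    (hu : 0 < u) (hv : u < v) (hw : v < w)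
    (h5 : 0 < (u + v + w) - (a + b + c))
    (h4 : 0 < (u * v + u * w + v * w) - (a + b + c) * (u + v + w) + (a * b + a * c + b * c)) :
    c ≤ w := by
  by_contra! hwc
  have hg : 0 ≤ u * (c - v) + v * (c - w) + w * (c - u) := by
    have := mul_nonneg hu.le (show 0 ≤ c - v by linarith)
    have := mul_nonneg (hu.trans hv).le (show 0 ≤ c - w by linarith)
    have := mul_nonneg ((hu.trans hv).trans hw).le (show 0 ≤ c - u by linarith)
    linarith
  have hs : 3 / 2 * (a + b + c) ≤ u + v + w := by
    nlinarith [sq_nonneg (u - v), sq_nonneg (u - w), sq_nonneg (v - w), sq_nonneg (a - b),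
      sq_nonneg (a - c), sq_nonneg (b - c)]
  have h6 : (a + b) * (3 / 2 * (a + b + c)) ≤ (a + b) * (u + v + w) :=
    mul_le_mul_of_nonneg_left hs (by linarith)
  nlinarith [mul_pos ha (ha.trans hb), sq_nonneg (a + b), mul_pos ha (ha.trans (hb.trans hc)),
    mul_pos (ha.trans hb) (ha.trans (hb.trans hc))]

/-- The inequality on the coefficient of `x ^ 4` forbids two negative moduli below `b`
when the largest modulus is the one of a negative root. -/
lemma middle_le_of_coeff_four_pos {a b c u v w : ℝ} (ha : 0 < a) (hb : a < b) (hc : b < c)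
    (hu : 0 < u) (hv : u < v) (hcw : c ≤ w)
    (h4 : 0 < (u * v + u * w + v * w) - (a + b + c) * (u + v + w) + (a * b + a * c + b * c)) :
    b ≤ v := by
  by_contra! hvb
  have h1 : 0 ≤ (a + b + c - u - v) * (w - c) :=
    mul_nonneg (by linarith) (by linarith)
  have h2 : 0 < (a + b) * (u + v) - u * v := by nlinarith
  nlinarith [mul_pos ha (ha.trans hb), sq_nonneg (c - b), mul_pos (ha.trans hb) (hu.trans hv),
    mul_pos ha (ha.trans (hb.trans hc)), mul_pos (ha.trans hb) (ha.trans (hb.trans hc)),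
    mul_pos ha hu, mul_pos (ha.trans hb) hu]

/-- A polynomial `x ^ 6 + p x ^ 4 - q x ^ 2 - r` with nonnegative `p` and positive `r` has at most
one sign change on the positive half-line. -/
lemma even_part_pos {p r q x z : ℝ} (hp : 0 ≤ p) (hr : 0 < r) (hx : 0 < x) (hxz : x < z)
    (h : 0 ≤ x ^ 6 + p * x ^ 4 - q * x ^ 2 - r) : 0 < z ^ 6 + p * z ^ 4 - q * z ^ 2 - r := by
  have hz := hx.trans hxz
  have hsq : x ^ 2 < z ^ 2 := by gcongr
  have hx2 : 0 < x ^ 2 := by positivity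
  have hz2 : 0 < z ^ 2 := by positivity
  have key : x ^ 2 * (z ^ 6 + p * z ^ 4 - q * z ^ 2 - r) =
      z ^ 2 * (x ^ 6 + p * x ^ 4 - q * x ^ 2 - r)
        + (z ^ 2 - x ^ 2) * (x ^ 2 * z ^ 2 * (z ^ 2 + x ^ 2) + p * x ^ 2 * z ^ 2 + r) := by ring
  have h1 : 0 < (z ^ 2 - x ^ 2) * (x ^ 2 * z ^ 2 * (z ^ 2 + x ^ 2) + p * x ^ 2 * z ^ 2 + r) :=
    mul_pos (by linarith) (by positivity)
  exact pos_of_mul_pos_right (key ▸ add_pos_of_nonneg_of_pos (mul_nonneg hz2.le h) h1) hx2.le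

/-- An odd quintic with positive leading coefficient cannot take the signs `≤ 0`, `> 0`, `< 0`
at three increasing positive points. -/
lemma odd_part_oscillation {p q r x y z : ℝ} (hp : 0 < p) (hx : 0 < x) (hxy : x < y) (hyz : y < z)
    (h1 : p * x ^ 5 - q * x ^ 3 + r * x ≤ 0) (h2 : 0 < p * y ^ 5 - q * y ^ 3 + r * y)
    (h3 : p * z ^ 5 - q * z ^ 3 + r * z < 0) : False := by
  have hy := hx.trans hxy
  have hz := hy.trans hyz
  have hA : x ^ 2 < y ^ 2 := by gcongr
  have hB : y ^ 2 < z ^ 2 := by gcongr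
  have h1' : p * (x ^ 2) ^ 2 - q * x ^ 2 + r ≤ 0 := by
    by_contra! h; nlinarith [mul_pos hx h]
  have h2' : 0 < p * (y ^ 2) ^ 2 - q * y ^ 2 + r := by
    by_contra! h; nlinarith [mul_nonneg hy.le (neg_nonneg.2 h)]
  have h3' : p * (z ^ 2) ^ 2 - q * z ^ 2 + r ≤ 0 := by
    by_contra! h; nlinarith [mul_pos hz h]
  generalize x ^ 2 = A at *
  generalize y ^ 2 = B at *
  generalize z ^ 2 = D at *
  have key : (D - A) * (p * B ^ 2 - q * B + r) = (D - B) * (p * A ^ 2 - q * A + r)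
      + (B - A) * (p * D ^ 2 - q * D + r) - p * (B - A) * (D - B) * (D - A) := by ring
  have k0 : 0 < (D - A) * (p * B ^ 2 - q * B + r) := mul_pos (by linarith) h2'
  have k1 := mul_nonneg (sub_pos.2 hB).le (neg_nonneg.2 h1')
  have k2 := mul_nonneg (sub_pos.2 hA).le (neg_nonneg.2 h3')
  have k3 : 0 < p * (B - A) * (D - B) * (D - A) :=
    mul_pos (mul_pos (mul_pos hp (by linarith)) (by linarith)) (by linarith)
  linarith

/-- The signs of the coefficients forbid the interlacing `u < b < v < c` of moduli. -/
lemma not_interlacing {a b c u v w : ℝ} (ha : 0 < a) (hu : 0 < u) (hw : 0 < w)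
    (hub : u < b) (hbv : b < v) (hvc : v < c)
    (h5 : 0 < (u + v + w) - (a + b + c))
    (h4 : 0 < (u * v + u * w + v * w) - (a + b + c) * (u + v + w) + (a * b + a * c + b * c)) :
    False := by
  have hb := hu.trans hub
  have hv := hb.trans hbv
  have hc := hv.trans hvc
  obtain ⟨p5, e5⟩ : ∃ p, p = (u + v + w) - (a + b + c) := ⟨_, rfl⟩
  obtain ⟨p4, e4⟩ : ∃ p, p = (u * v + u * w + v * w) - (a + b + c) * (u + v + w)
    + (a * b + a * c + b * c) := ⟨_, rfl⟩
  obtain ⟨p3, e3⟩ : ∃ p, p = -(u * v * w - (a + b + c) * (u * v + u * w + v * w)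
          + (a * b + a * c + b * c) * (u + v + w) - a * b * c) := ⟨_, rfl⟩
  obtain ⟨p2, e2⟩ : ∃ p, p = -(-(a + b + c) * (u * v * w)
          + (a * b + a * c + b * c) * (u * v + u * w + v * w)
          - a * b * c * (u + v + w)) := ⟨_, rfl⟩
  obtain ⟨p1, e1⟩ : ∃ p, p = (a * b + a * c + b * c) * (u * v * w)
    - a * b * c * (u * v + u * w + v * w) := ⟨_, rfl⟩
  obtain ⟨p0, e0⟩ : ∃ p, p = a * b * c * (u * v * w) := ⟨_, rfl⟩
  have hp0 : 0 < p0 := by rw [e0]; positivity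
  rw [← e5] at h5
  rw [← e4] at h4
  have expand (x : ℝ) : (x ^ 6 + p4 * x ^ 4 - p2 * x ^ 2 - p0) + (p5 * x ^ 5 - p3 * x ^ 3 + p1 * x)
      = (x - a) * (x - b) * (x - c) * (x + u) * (x + v) * (x + w) := by
    subst e5 e4 e3 e2 e1 e0; ring
  have Eb : b ^ 6 + p4 * b ^ 4 - p2 * b ^ 2 - p0 = -(p5 * b ^ 5 - p3 * b ^ 3 + p1 * b) := by
    linear_combination expand b
  have Ec : c ^ 6 + p4 * c ^ 4 - p2 * c ^ 2 - p0 = -(p5 * c ^ 5 - p3 * c ^ 3 + p1 * c) := by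
    linear_combination expand c
  have Eu : u ^ 6 + p4 * u ^ 4 - p2 * u ^ 2 - p0 = p5 * u ^ 5 - p3 * u ^ 3 + p1 * u := by
    linear_combination expand (-u)
  have Ev : v ^ 6 + p4 * v ^ 4 - p2 * v ^ 2 - p0 = p5 * v ^ 5 - p3 * v ^ 3 + p1 * v := by
    linear_combination expand (-v)
  rcases le_or_gt 0 (u ^ 6 + p4 * u ^ 4 - p2 * u ^ 2 - p0) with h | h
  · have hb' := even_part_pos h4.le hp0 hu hub h
    have hv' := even_part_pos h4.le hp0 hb hbv hb'.le
    have hc' := even_part_pos h4.le hp0 hv hvc hv'.le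
    exact odd_part_oscillation (q := p3) (r := p1) h5 hb hbv hvc
      (by linarith) (by linarith) (by linarith)
  rcases lt_or_ge (b ^ 6 + p4 * b ^ 4 - p2 * b ^ 2 - p0) 0 with h' | h'
  · rcases lt_or_ge (v ^ 6 + p4 * v ^ 4 - p2 * v ^ 2 - p0) 0 with h'' | h''
    · exact odd_part_oscillation (q := p3) (r := p1) h5 hu hub hbv
        (by linarith) (by linarith) (by linarith)
    · have hc' := even_part_pos h4.le hp0 hv hvc h''
      exact odd_part_oscillation (q := p3) (r := p1) h5 hu hub (hbv.trans hvc)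
        (by linarith) (by linarith) (by linarith)
  · have hv' := even_part_pos h4.le hp0 hb hbv h'
    have hc' := even_part_pos h4.le hp0 hv hvc hv'.le
    exact odd_part_oscillation (q := p3) (r := p1) h5 hu (hub.trans hbv) hvc
      (by linarith) (by linarith) (by linarith)

/-- The couple `(Σ_{3,2,1,1}, Ω)` is realizable iff `Ω` is one of
`PPPNNN`, `PPNPNN`, `PPNNPN`, `PNPPNN`. -/
theorem sigma3211_realizable_orders (Ω : Fin 6 → Bool)
    (hΩ : (Finset.univ.filter fun i => Ω i = true).card = 3) :
    realizable ![true, true, true, false, false, true, false] Ω ↔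
      (Ω = ![true, true, true, false, false, false] ∨
       Ω = ![true, true, false, true, false, false] ∨
       Ω = ![true, true, false, false, true, false] ∨
       Ω = ![true, false, true, true, false, false]) := by
  constructor
  · rintro ⟨a, b, c, u, v, w, ha, hab, hbc, hu, huv, hvw, hau, hav, haw, hbu, hbv, hbw,
      hcu, hcv, hcw, hord, hsig⟩
    rw [hp6_eq_s3, hasSigns_iff_of_monic_sextic] at hsig
    obtain ⟨h5, h4, -, h2, h1, -⟩ := hsig
    have hau' : a < u :=
      lt_of_le_of_ne (least_modulus_pos ha hab hbc hu (hu.trans huv)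
        ((hu.trans huv).trans hvw) h2 h1) hau
    have hcw' : c < w := lt_of_le_of_ne (largest_modulus_neg ha hab hbc hu huv hvw h5 h4) hcw
    have hbv' : b < v :=
      lt_of_le_of_ne (middle_le_of_coeff_four_pos ha hab hbc hu huv hcw'.le h4) hbv
    have hw := (hu.trans huv).trans hvw
    have hne : (u ≠ a ∧ v ≠ a ∧ w ≠ a) ∧ (u ≠ b ∧ v ≠ b ∧ w ≠ b) ∧ u ≠ c ∧ v ≠ c ∧ w ≠ c :=
      ⟨⟨hau.symm, hav.symm, haw.symm⟩, ⟨hbu.symm, hbv.symm, hbw.symm⟩,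
        hcu.symm, hcv.symm, hcw.symm⟩
    rcases lt_or_gt_of_ne hbu with hbu' | hbu'
    · rcases lt_or_gt_of_ne hcu with hcu' | hcu'
      · have key := hord.apply_iff (strictMono_vec6 hab hbc hcu' huv hvw)
          (by rw [range_vec6])
        left
        ext i
        rw [Bool.eq_iff_iff, key i]
        fin_cases i <;> simp [hne]
      · rcases lt_or_gt_of_ne hcv with hcv' | hcv'
        · have key := hord.apply_iff (strictMono_vec6 hab hbu' hcu' hcv' hvw)
            (by rw [range_vec6]; grind)
          right; left
          ext i
          rw [Bool.eq_iff_iff, key i]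
          fin_cases i <;> simp [hne]
        · have key := hord.apply_iff (strictMono_vec6 hab hbu' huv hcv' hcw')
            (by rw [range_vec6]; grind)
          right; right; left
          ext i
          rw [Bool.eq_iff_iff, key i]
          fin_cases i <;> simp [hne]
    · have hcv' : c < v := lt_of_le_of_ne
        (not_lt.1 fun h => not_interlacing ha hu hw hbu' hbv' h h5 h4) hcv
      have key := hord.apply_iff (strictMono_vec6 hau' hbu' hbc hcv' hvw)
        (by rw [range_vec6]; grind)
      right; right; right
      ext i
      rw [Bool.eq_iff_iff, key i]
      fin_cases i <;> simp [hne]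
  · rintro (rfl | rfl | rfl | rfl)
    · refine ⟨1, 2, 3, 4, 6, 7, by norm_num, by norm_num, by norm_num, by norm_num, by norm_num,
        by norm_num, by norm_num, by norm_num, by norm_num, by norm_num, by norm_num, by norm_num,
        by norm_num, by norm_num, by norm_num, ⟨![1, 2, 3, 4, 6, 7], ?_, ?_, ?_⟩, ?_⟩
      · apply strictMono_vec6 <;> norm_num
      · rw [range_vec6]
      · intro i; fin_cases i <;> norm_num
      · rw [hp6_eq_s3, hasSigns_iff_of_monic_sextic]; norm_num
    · refine ⟨1, 2, 4, 3, 9, 10, by norm_num, by norm_num, by norm_num, by norm_num, by norm_num,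
        by norm_num, by norm_num, by norm_num, by norm_num, by norm_num, by norm_num, by norm_num,
        by norm_num, by norm_num, by norm_num, ⟨![1, 2, 3, 4, 9, 10], ?_, ?_, ?_⟩, ?_⟩
      · apply strictMono_vec6 <;> norm_num
      · rw [range_vec6]; grind
      · intro i; fin_cases i <;> norm_num
      · rw [hp6_eq_s3, hasSigns_iff_of_monic_sextic]; norm_num
    · refine ⟨1, 2, 13, 11, 12, 28, by norm_num, by norm_num, by norm_num, by norm_num, by norm_num,
        by norm_num, by norm_num, by norm_num, by norm_num, by norm_num, by norm_num, by norm_num,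
        by norm_num, by norm_num, by norm_num, ⟨![1, 2, 11, 12, 13, 28], ?_, ?_, ?_⟩, ?_⟩
      · apply strictMono_vec6 <;> norm_num
      · rw [range_vec6]; grind
      · intro i; fin_cases i <;> norm_num
      · rw [hp6_eq_s3, hasSigns_iff_of_monic_sextic]; norm_num
    · refine ⟨1, 6, 7, 5, 31, 33, by norm_num, by norm_num, by norm_num, by norm_num, by norm_num,
        by norm_num, by norm_num, by norm_num, by norm_num, by norm_num, by norm_num, by norm_num,
        by norm_num, by norm_num, by norm_num, ⟨![1, 5, 6, 7, 31, 33], ?_, ?_, ?_⟩, ?_⟩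
      · apply strictMono_vec6 <;> norm_num
      · rw [range_vec6]; grind
      · intro i; fin_cases i <;> norm_num
      · rw [hp6_eq_s3, hasSigns_iff_of_monic_sextic]; norm_num
end

section
/- Let 0 < γ1 < α1 < γ2 < α2 < α3 < γ3 be real numbers. Then α1α2 + α1α3 + α2α3 + γ1γ2 + γ1γ3 + γ2γ3 − (α1γ1 + α1γ2 + α1γ3 + α2γ1 + α2γ2 + α2γ3 + α3γ1 + α3γ2 + α3γ3) < 0; equivalently, the coefficient of x⁴ of the polynomial (x−α1)(x−α2)(x−α3)(x+γ1)(x+γ2)(x+γ3) is negative. (Consequently the order of moduli NPNPPN cannot occur together with a sign pattern whose x⁴-coefficient sign is +, such as Σ_{3,1,2,1} or Σ_{3,2,1,1}.) -/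
/-- For moduli ordered as `γ1 < α1 < γ2 < α2 < α3 < γ3` (order of moduli `NPNPPN`), the
coefficient of `x^4` of `(x-α1)(x-α2)(x-α3)(x+γ1)(x+γ2)(x+γ3)`, i.e. the second
elementary symmetric function of the roots, is negative. -/
theorem coeff4_neg_NPNPPN (α1 α2 α3 γ1 γ2 γ3 : ℝ)
    (h0 : 0 < γ1) (h1 : γ1 < α1) (h2 : α1 < γ2) (h3 : γ2 < α2)
    (h4 : α2 < α3) (h5 : α3 < γ3) :
    α1 * α2 + α1 * α3 + α2 * α3 + γ1 * γ2 + γ1 * γ3 + γ2 * γ3 -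
      (α1 * γ1 + α1 * γ2 + α1 * γ3 + α2 * γ1 + α2 * γ2 + α2 * γ3 +
       α3 * γ1 + α3 * γ2 + α3 * γ3) < 0 := by
  have hsum : (α1 + α2 + α3 - γ1 - γ2 - γ3) ^ 2 < α2 ^ 2 + γ3 ^ 2 := by
    rcases le_total 0 (α1 + α2 + α3 - γ1 - γ2 - γ3) with h | h
    · nlinarith [sq_nonneg γ3]
    · nlinarith [sq_nonneg α2]
  nlinarith [sq_nonneg α1, sq_nonneg α3, sq_nonneg γ1, sq_nonneg γ2]
end

section
/- Let 0 < γ1 < α1 < α2 < γ2 < α3 < γ3 be real numbers. Then α1α2 + α1α3 + α2α3 + γ1γ2 + γ1γ3 + γ2γ3 − (α1γ1 + α1γ2 + α1γ3 + α2γ1 + α2γ2 + α2γ3 + α3γ1 + α3γ2 + α3γ3) < 0; equivalently, the coefficient of x⁴ of the polynomial (x−α1)(x−α2)(x−α3)(x+γ1)(x+γ2)(x+γ3) is negative. (Consequently the order of moduli NPPNPN cannot occur together with a sign pattern whose x⁴-coefficient sign is +, such as Σ_{3,1,2,1} or Σ_{3,2,1,1}.) -/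
/-- For moduli ordered as `γ1 < α1 < α2 < γ2 < α3 < γ3` (order of moduli `NPPNPN`), the
coefficient of `x^4` of `(x-α1)(x-α2)(x-α3)(x+γ1)(x+γ2)(x+γ3)`, i.e. the second
elementary symmetric function of the roots, is negative. -/
theorem coeff4_neg_NPPNPN (α1 α2 α3 γ1 γ2 γ3 : ℝ)
    (h0 : 0 < γ1) (h1 : γ1 < α1) (h2 : α1 < α2) (h3 : α2 < γ2)
    (h4 : γ2 < α3) (h5 : α3 < γ3) :
    α1 * α2 + α1 * α3 + α2 * α3 + γ1 * γ2 + γ1 * γ3 + γ2 * γ3 -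
      (α1 * γ1 + α1 * γ2 + α1 * γ3 + α2 * γ1 + α2 * γ2 + α2 * γ3 +
       α3 * γ1 + α3 * γ2 + α3 * γ3) < 0 := by
  have hlt : α1 + α2 + α3 - γ1 - γ2 - γ3 < γ3 := by linarith
  have hgt : -γ3 < α1 + α2 + α3 - γ1 - γ2 - γ3 := by linarith
  have hsq : (α1 + α2 + α3 - γ1 - γ2 - γ3) ^ 2 < γ3 ^ 2 := sq_lt_sq' hgt hlt
  linarith [sq_nonneg α1, sq_nonneg α2, sq_nonneg α3, sq_nonneg γ1, sq_nonneg γ2]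
end
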